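/- arXiv:1801.08664 — 2 statements merged into one kernel-verified Lean document; each statement's English description precedes it below -/
import Mathlib

section
/- Let s = I(u, L^{(N+1)/2} v) be the interleaved sequence of period 2N. Then deg gcd(S_s(x), x^{2N} − 1) ≤ 5 in F_2[x]; consequently the linear complexity of s satisfies LC(s) ≥ 2N − 5. -/
open Finset Polynomial

def Dclass (N f : ℕ) (β : ZMod N) (j : ℕ) : Set (ZMod N) :=
  {x | ∃ k < f, x = β ^ (4 * k + j)}

open Classical in
/-- The binary sequence of period `N` whose characteristic set is `S ⊆ Z_N`. -/
noncomputable def chiSeq (N : ℕ) (S : Set (ZMod N)) : ℤ → ℕ :=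
  fun t => if (t : ZMod N) ∈ S then 1 else 0

/-- The interleaved sequence `I(a,b)`: `I(a,b)(2i) = a(i)`, `I(a,b)(2i+1) = b(i)`. -/
noncomputable def interleave (a b : ℤ → ℕ) : ℤ → ℕ :=
  fun k => if Even k then a (k / 2) else b ((k - 1) / 2)

/-- The left shift `L^m`. -/
def shiftL (m : ℤ) (a : ℤ → ℕ) : ℤ → ℕ := fun i => a (i + m)

/-- The sequence polynomial over F_2 of a sequence of period `n`. -/
noncomputable def Spoly (n : ℕ) (s : ℤ → ℕ) : Polynomial (ZMod 2) :=
  ∑ i ∈ Finset.range n, Polynomial.C ((s (i : ℤ) : ZMod 2)) * Polynomial.X ^ i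

theorem sum_range_natCast_zmod {N : ℕ} [NeZero N] {M : Type*} [AddCommMonoid M] (F : ZMod N → M) :
    ∑ i ∈ range N, F (i : ZMod N) = ∑ a, F a := by
  refine Finset.sum_bij' (fun i _ => (i : ZMod N)) (fun a _ => a.val) ?_ ?_ ?_ ?_ ?_
  · simp
  · exact fun a _ => mem_range.2 (ZMod.val_lt a)
  · exact fun i hi => ZMod.val_cast_of_lt (mem_range.1 hi)
  · exact fun a _ => ZMod.natCast_zmod_val a
  · simp

theorem sum_range_two_mul {M : Type*} [AddCommMonoid M] (F : ℕ → M) (n : ℕ) :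
    ∑ i ∈ range (2 * n), F i = ∑ i ∈ range n, F (2 * i) + ∑ i ∈ range n, F (2 * i + 1) := by
  induction n with
  | zero => simp
  | succ n ih =>
    rw [Nat.mul_succ, sum_range_succ, sum_range_succ, ih, sum_range_succ, sum_range_succ]
    abel

/-- The exponential `a ↦ θ ^ a` on `ℤ/N`, meaningful when `θ ^ N = 1`. -/
def zmodPow {R : Type*} [Monoid R] {N : ℕ} (θ : R) (a : ZMod N) : R := θ ^ a.val

section zmodPow

variable {R : Type*} {N : ℕ} {θ : R}

theorem zmodPow_natCast [Monoid R] (hθ : θ ^ N = 1) (k : ℕ) :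
    zmodPow θ (k : ZMod N) = θ ^ k := by
  rw [zmodPow, ZMod.val_natCast, ← pow_eq_pow_mod k hθ]

theorem zmodPow_two_mul [Monoid R] [NeZero N] (hθ : θ ^ N = 1) (a : ZMod N) :
    zmodPow θ (2 * a) = zmodPow θ a ^ 2 := by
  obtain ⟨k, rfl⟩ := ZMod.natCast_zmod_surjective a
  rw [zmodPow_natCast hθ, ← pow_mul, mul_comm k, ← zmodPow_natCast hθ]
  push_cast
  rfl

/-- The sum of `θ ^ a` over the nonzero quadratic residues `a` modulo `N`. -/
noncomputable def residuePeriod [CommRing R] (N : ℕ) [Fact N.Prime] (θ : R) : R :=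
  ∑ a : ZMod N, if quadraticChar (ZMod N) a = 1 then zmodPow θ a else 0

theorem residuePeriod_sq [CommRing R] [CharP R 2] [Fact N.Prime] (hθ : θ ^ N = 1) :
    residuePeriod N θ ^ 2 =
      ∑ a : ZMod N, if quadraticChar (ZMod N) a = 1 then zmodPow θ (2 * a) else 0 := by
  rw [residuePeriod, CharTwo.sum_sq]
  refine sum_congr rfl fun a _ => ?_
  split_ifs
  · rw [zmodPow_two_mul hθ]
  · simp

theorem quadraticChar_two_eq_neg_one [Fact N.Prime] (hN : N % 8 = 5) :
    quadraticChar (ZMod N) 2 = -1 := by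
  rw [quadraticChar_neg_one_iff_not_isSquare, ZMod.exists_sq_eq_two_iff (by omega)]
  omega

theorem residuePeriod_sq_add [CommRing R] [CharP R 2] [Fact N.Prime] (hN : N % 8 = 5)
    (hθ : θ ^ N = 1) (hsum : ∑ i ∈ range N, θ ^ i = 0) :
    residuePeriod N θ ^ 2 + residuePeriod N θ + 1 = 0 := by
  have h2 : (2 : ZMod N) ≠ 0 := by
    intro h
    have := quadraticChar_two_eq_neg_one hN
    rw [h, quadraticChar_zero] at this
    omega
  have hsq : residuePeriod N θ ^ 2 =
      ∑ a : ZMod N, if quadraticChar (ZMod N) a = -1 then zmodPow θ a else 0 := by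
    rw [residuePeriod_sq hθ]
    refine Fintype.sum_equiv (Equiv.mulLeft₀ 2 h2) _ _ fun a => ?_
    rw [show Equiv.mulLeft₀ 2 h2 a = 2 * a from rfl, map_mul, quadraticChar_two_eq_neg_one hN, neg_one_mul]
    simp only [neg_inj]
  have hone : (1 : R) = ∑ a : ZMod N, if a = 0 then zmodPow θ a else 0 := by
    simp [zmodPow]
  rw [hsq, hone, residuePeriod, ← sum_add_distrib, ← sum_add_distrib]
  simp_rw [← zmodPow_natCast hθ] at hsum
  rw [sum_range_natCast_zmod] at hsum
  refine Eq.trans ?_ hsum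
  refine sum_congr rfl fun a _ => ?_
  by_cases ha : a = 0
  · simp [ha]
  · rcases quadraticChar_dichotomy ha with h | h <;> simp [ha, h]

end zmodPow

section cyclotomicClasses

variable {N f : ℕ} {β : ZMod N}

theorem pow_mem_Dclass_iff (hβ : IsPrimitiveRoot β (4 * f)) {m j : ℕ} (hm : m < 4 * f)
    (hj : j < 4) : β ^ m ∈ Dclass N f β j ↔ m % 4 = j := by
  constructor
  · rintro ⟨k, hk, h⟩
    have := hβ.pow_inj hm (by omega) h
    omega
  · intro h
    exact ⟨m / 4, by omega, by congr 1; omega⟩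

theorem zero_notMem_Dclass [Fact N.Prime] (hβ : β ≠ 0) (j : ℕ) : 0 ∉ Dclass N f β j := by
  rintro ⟨k, -, h⟩
  exact pow_ne_zero _ hβ h.symm

theorem quadraticChar_eq_neg_one_of_isPrimitiveRoot [Fact N.Prime] (hf : 0 < f)
    (hN : N = 4 * f + 1) (hβ : IsPrimitiveRoot β (4 * f)) : quadraticChar (ZMod N) β = -1 := by
  rw [quadraticChar_neg_one_iff_not_isSquare]
  intro hsq
  have hβ0 : β ≠ 0 := hβ.ne_zero (by omega)
  have h1 := (ZMod.euler_criterion N hβ0).1 hsq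
  have h2 := hβ.dvd_of_pow_eq_one _ h1
  have := Nat.le_of_dvd (by omega) h2
  omega

open Classical in
theorem chi_add_chi_eq [Fact N.Prime] {R : Type*} [CommRing R] [CharP R 2] (hf : 0 < f)
    (hN : N = 4 * f + 1) (hβ : IsPrimitiveRoot β (4 * f)) (a : ZMod N) :
    ((if a ∈ Dclass N f β 0 ∪ Dclass N f β 1 then 1 else 0 : R) +
      if a ∈ Dclass N f β 1 ∪ Dclass N f β 2 then 1 else 0) =
      if quadraticChar (ZMod N) a = 1 then 1 else 0 := by
  have hβ0 : β ≠ 0 := hβ.ne_zero (by omega)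
  by_cases ha : a = 0
  · simp [ha, zero_notMem_Dclass hβ0]
  have : NeZero (4 * f) := ⟨by omega⟩
  obtain ⟨m, hm, rfl⟩ := hβ.eq_pow_of_pow_eq_one (ξ := a) (by
    rw [show 4 * f = N - 1 by omega]
    exact ZMod.pow_card_sub_one_eq_one ha)
  have h4 : m % 4 < 4 := Nat.mod_lt _ (by norm_num)
  simp only [Set.mem_union, pow_mem_Dclass_iff hβ hm (show 0 < 4 by norm_num),
    pow_mem_Dclass_iff hβ hm (show 1 < 4 by norm_num),
    pow_mem_Dclass_iff hβ hm (show 2 < 4 by norm_num), map_pow,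
    quadraticChar_eq_neg_one_of_isPrimitiveRoot hf hN hβ]
  rcases Nat.even_or_odd m with he | ho
  · have : m % 4 = 0 ∨ m % 4 = 2 := by rw [Nat.even_iff] at he; omega
    rcases this with h | h <;> simp [h, he.neg_one_pow]
  · have : m % 4 = 1 ∨ m % 4 = 3 := by rw [Nat.odd_iff] at ho; omega
    rcases this with h | h <;> simp [h, ho.neg_one_pow, CharTwo.add_self_eq_zero]

end cyclotomicClasses

theorem interleave_two_mul (a b : ℤ → ℕ) (i : ℕ) :
    interleave a b ((2 * i : ℕ) : ℤ) = a i := by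
  simp [interleave]

theorem interleave_two_mul_add_one (a b : ℤ → ℕ) (i : ℕ) :
    interleave a b ((2 * i + 1 : ℕ) : ℤ) = b i := by
  simp [interleave]

theorem aeval_Spoly {R : Type*} [CommRing R] [Algebra (ZMod 2) R] (n : ℕ) (s : ℤ → ℕ) (θ : R) :
    aeval θ (Spoly n s) = ∑ i ∈ range n, (s i : R) * θ ^ i := by
  simp [Spoly]

open Classical in
theorem aeval_Spoly_interleave_shiftL {R : Type*} [CommRing R] [Algebra (ZMod 2) R] {N : ℕ}
    [NeZero N] {θ : R} (hθ : θ ^ N = 1) {h : ℕ} (hh : 2 * (h : ZMod N) = 1) (A B : Set (ZMod N)) :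
    aeval θ (Spoly (2 * N) (interleave (chiSeq N A) (shiftL h (chiSeq N B)))) =
      ∑ a : ZMod N, ((if a ∈ A then 1 else 0) + if a ∈ B then 1 else 0) * zmodPow θ (2 * a) := by
  rw [aeval_Spoly, sum_range_two_mul]
  simp_rw [interleave_two_mul, interleave_two_mul_add_one, add_mul, sum_add_distrib]
  congr 1
  · rw [← sum_range_natCast_zmod]
    refine sum_congr rfl fun i _ => ?_
    rw [← zmodPow_natCast hθ]
    simp [chiSeq]
  · rw [← Equiv.sum_comp (Equiv.addRight (h : ZMod N)), ← sum_range_natCast_zmod]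
    refine sum_congr rfl fun i _ => ?_
    rw [← zmodPow_natCast hθ]
    simp [chiSeq, shiftL, mul_add, hh]
    by_cases hB : (i : ZMod N) + h ∈ B <;> simp [hB]

theorem aeval_Spoly_eq_residuePeriod_sq {R : Type*} [CommRing R] [Algebra (ZMod 2) R] [CharP R 2]
    {N f : ℕ} [Fact N.Prime] (hf : 0 < f) (hN : N = 4 * f + 1) {β : ZMod N}
    (hβ : IsPrimitiveRoot β (4 * f)) {θ : R} (hθ : θ ^ N = 1) :
    aeval θ (Spoly (2 * N) (interleave (chiSeq N (Dclass N f β 0 ∪ Dclass N f β 1))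
      (shiftL (((N + 1) / 2 : ℕ) : ℤ) (chiSeq N (Dclass N f β 1 ∪ Dclass N f β 2))))) =
      residuePeriod N θ ^ 2 := by
  have hhalf : 2 * (((N + 1) / 2 : ℕ) : ZMod N) = 1 := by
    have h : 2 * ((N + 1) / 2) = N + 1 := by omega
    simpa only [Nat.cast_mul, Nat.cast_ofNat, Nat.cast_add, Nat.cast_one, CharP.cast_eq_zero,
      zero_add] using congrArg (Nat.cast : ℕ → ZMod N) h
  rw [aeval_Spoly_interleave_shiftL hθ hhalf, residuePeriod_sq hθ]
  refine sum_congr rfl fun a _ => ?_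
  rw [← boole_mul (quadraticChar (ZMod N) a = 1)]
  congr 1
  convert chi_add_chi_eq (R := R) hf hN hβ a

theorem isCoprime_of_isUnit_aeval_root {K : Type*} [CommRing K] {p q : K[X]}
    (h : IsUnit (aeval (AdjoinRoot.root q) p)) : IsCoprime p q := by
  obtain ⟨t, ht⟩ := h.exists_left_inv
  obtain ⟨t, rfl⟩ := AdjoinRoot.mk_surjective t
  rw [AdjoinRoot.aeval_eq, ← map_mul, ← map_one (AdjoinRoot.mk q), AdjoinRoot.mk_eq_mk] at ht
  obtain ⟨c, hc⟩ := ht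
  exact ⟨t, -c, by linear_combination hc⟩

theorem isCoprime_Spoly_geom_sum {N f : ℕ} [Fact N.Prime] (hf : Odd f) (hN : N = 4 * f + 1)
    {β : ZMod N} (hβ : IsPrimitiveRoot β (4 * f)) :
    IsCoprime (Spoly (2 * N) (interleave (chiSeq N (Dclass N f β 0 ∪ Dclass N f β 1))
      (shiftL (((N + 1) / 2 : ℕ) : ℤ) (chiSeq N (Dclass N f β 1 ∪ Dclass N f β 2)))))
      (∑ i ∈ range N, X ^ i : (ZMod 2)[X]) := by
  set Φ : (ZMod 2)[X] := ∑ i ∈ range N, X ^ i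
  refine isCoprime_of_isUnit_aeval_root ?_
  have hsum : ∑ i ∈ range N, AdjoinRoot.root Φ ^ i = 0 := by
    simp_rw [← AdjoinRoot.mk_X, ← map_pow, ← map_sum]
    exact AdjoinRoot.mk_self
  have hθ : AdjoinRoot.root Φ ^ N = 1 := by
    have := geom_sum_mul (AdjoinRoot.root Φ) N
    rw [hsum, zero_mul] at this
    exact (sub_eq_zero.1 this.symm)
  rcases subsingleton_or_nontrivial (AdjoinRoot Φ) with _ | _
  · exact isUnit_of_subsingleton _
  have : CharP (AdjoinRoot Φ) 2 := charP_of_injective_algebraMap' (ZMod 2) 2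
  rw [aeval_Spoly_eq_residuePeriod_sq hf.pos hN hβ hθ]
  have hmod : N % 8 = 5 := by
    rw [Nat.odd_iff] at hf
    omega
  have hq := residuePeriod_sq_add hmod hθ hsum
  refine IsUnit.pow 2 (IsUnit.of_mul_eq_one (-(residuePeriod N (AdjoinRoot.root Φ) + 1)) ?_)
  linear_combination -hq

theorem natDegree_gcd_X_pow_sub_one_le {S : (ZMod 2)[X]} {N : ℕ}
    (h : IsCoprime S (∑ i ∈ range N, X ^ i)) :
    (EuclideanDomain.gcd S (X ^ (2 * N) - 1)).natDegree ≤ 2 := by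
  have hfac : (X ^ (2 * N) - 1 : (ZMod 2)[X]) = (∑ i ∈ range N, X ^ i) ^ 2 * (X - C 1) ^ 2 := by
    rw [← mul_pow, C_1, geom_sum_mul, sub_pow_char, one_pow, ← pow_mul, mul_comm]
  have hdvd : EuclideanDomain.gcd S (X ^ (2 * N) - 1) ∣ (X - C 1) ^ 2 := by
    have hcop := (h.of_isCoprime_of_dvd_left
      (EuclideanDomain.gcd_dvd_left S (X ^ (2 * N) - 1))).pow_right (n := 2)
    exact hcop.dvd_of_dvd_mul_left (hfac ▸ EuclideanDomain.gcd_dvd_right S (X ^ (2 * N) - 1))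
  refine (natDegree_le_of_dvd hdvd (pow_ne_zero 2 (X_sub_C_ne_zero 1))).trans ?_
  rw [natDegree_pow, natDegree_X_sub_C]

/-- lower bound on the linear complexity of `s = I(u, L^{(N+1)/2} v)`. -/
theorem stmt17 (N f y : ℕ) (hprime : N.Prime) (hNf : N = 4 * f + 1) (hN5 : 5 ≤ N)
    (hfy : f = y ^ 2) (hy : 0 < y) (hfodd : Odd f)
    (β : ZMod N) (hβ : orderOf β = N - 1)
    (u v s : ℤ → ℕ)
    (hu : u = chiSeq N (Dclass N f β 0 ∪ Dclass N f β 1))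
    (hv : v = chiSeq N (Dclass N f β 1 ∪ Dclass N f β 2))
    (hs : s = interleave u (shiftL (((N + 1) / 2 : ℕ) : ℤ) v)) :
    (EuclideanDomain.gcd (Spoly (2 * N) s) (X ^ (2 * N) - 1)).natDegree ≤ 5 ∧
    2 * N - 5 ≤
      2 * N - (EuclideanDomain.gcd (Spoly (2 * N) s) (X ^ (2 * N) - 1)).natDegree := by
  have : Fact N.Prime := ⟨hprime⟩
  have hβ' : IsPrimitiveRoot β (4 * f) := by
    rw [show 4 * f = orderOf β by omega]
    exact IsPrimitiveRoot.orderOf β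
  have hdeg : (EuclideanDomain.gcd (Spoly (2 * N) s) (X ^ (2 * N) - 1)).natDegree ≤ 2 := by
    subst hu hv hs
    exact natDegree_gcd_X_pow_sub_one_le (isCoprime_Spoly_geom_sum hfodd hNf hβ')
  omega
end

section
/- Suppose 2 mod N ∈ D_3. Then for each i ∈ {0,1,2,3} there is at most one j ∈ D_i such that 1 + α^{j(N+1)/2} S_v(α^j) = 0; consequently the polynomial 1 + x^{(N+1)/2} S_v(x) has at most 4 roots in the set {α^j : 1 ≤ j ≤ N−1}. -/
open Finset Polynomial

/-- Multiplication by a power of `β ^ 4` preserves each cyclotomic class of order 4. -/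
lemma Dclass_pow_mul {N f : ℕ} {β : ZMod N} (hf : 0 < f) (hβ : β ^ (4 * f) = 1) {j : ℕ}
    {x : ZMod N} (hx : x ∈ Dclass N f β j) (t : ℕ) : β ^ (4 * t) * x ∈ Dclass N f β j := by
  obtain ⟨k, -, rfl⟩ := hx
  refine ⟨(t + k) % f, Nat.mod_lt _ hf, ?_⟩
  have h : 4 * t + (4 * k + j) = 4 * f * ((t + k) / f) + (4 * ((t + k) % f) + j) := by
    have := Nat.div_add_mod (t + k) f
    rw [mul_assoc]
    omega
  rw [← pow_add, h, pow_add, pow_mul, hβ, one_pow, one_mul]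

/-- Two elements of the same cyclotomic class differ by a power of `β ^ 4`. -/
lemma exists_eq_pow_mul_of_mem_Dclass {N f : ℕ} {β : ZMod N} (hβ : β ^ (4 * f) = 1) {i : ℕ}
    {a b : ZMod N} (ha : a ∈ Dclass N f β i) (hb : b ∈ Dclass N f β i) :
    ∃ t, b = β ^ (4 * t) * a := by
  obtain ⟨k, hk, rfl⟩ := ha
  obtain ⟨l, -, rfl⟩ := hb
  refine ⟨l + (f - k), ?_⟩
  have h : 4 * (l + (f - k)) + (4 * k + i) = 4 * f + (4 * l + i) := by omega
  rw [← pow_add, h, pow_add _ (4 * f), hβ, one_mul]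

/-- The nonzero residues are covered by the cyclotomic classes of order 4. -/
lemma exists_mem_Dclass {N f : ℕ} [Fact N.Prime] (hf : 0 < f) (hN : N = 4 * f + 1) {β : ZMod N}
    (hβ : orderOf β = N - 1) {a : ZMod N} (ha : a ≠ 0) : ∃ i < 4, a ∈ Dclass N f β i := by
  have hN1 : N - 1 = 4 * f := by omega
  have : NeZero (N - 1) := ⟨by omega⟩
  obtain ⟨k, hk, rfl⟩ := (hβ ▸ IsPrimitiveRoot.orderOf β).eq_pow_of_pow_eq_one
    (ZMod.pow_card_sub_one_eq_one ha)
  exact ⟨k % 4, Nat.mod_lt _ (by norm_num), k / 4, by omega, by rw [Nat.div_add_mod]⟩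

open Classical in
/-- The sequence polynomial of a characteristic sequence at an `N`-th root of unity, as a sum
over residues. -/
lemma aeval_Spoly_chiSeq {N : ℕ} [NeZero N] {F : Type*} [Field F] [Algebra (ZMod 2) F] {α : F}
    (hα : α ^ N = 1) (S : Set (ZMod N)) (j : ZMod N) :
    aeval (α ^ j.val) (Spoly N (chiSeq N S)) =
      ∑ x : ZMod N, if x ∈ S then α ^ (x * j).val else 0 := by
  rw [Spoly, map_sum]
  refine Finset.sum_bij' (fun i _ => (i : ZMod N)) (fun x _ => x.val) (by simp)
    (fun x _ => Finset.mem_range.2 x.val_lt)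
    (fun i hi => ZMod.val_cast_of_lt (Finset.mem_range.1 hi)) (by simp) fun i hi => ?_
  have h : (α ^ j.val) ^ i = α ^ ((i : ZMod N) * j).val := by
    rw [ZMod.val_mul, ZMod.val_cast_of_lt (Finset.mem_range.1 hi), ← pow_mul, mul_comm,
      ← pow_mod_orderOf, ← pow_mod_orderOf α (_ % N),
      Nat.mod_mod_of_dvd _ (orderOf_dvd_of_pow_eq_one hα)]
  by_cases hS : (i : ZMod N) ∈ S <;> simp [chiSeq, hS, h]

/-- If `S` is stable under multiplication by `u` and by `u⁻¹`, the sequence polynomial takes the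
same value at `α ^ j` and `α ^ (u * j)`. -/
lemma aeval_Spoly_chiSeq_mul {N : ℕ} [NeZero N] {F : Type*} [Field F] [Algebra (ZMod 2) F] {α : F}
    (hα : α ^ N = 1) {S : Set (ZMod N)} (u : (ZMod N)ˣ) (hu : ∀ x, (u : ZMod N) * x ∈ S ↔ x ∈ S)
    (j : ZMod N) :
    aeval (α ^ ((u : ZMod N) * j).val) (Spoly N (chiSeq N S)) =
      aeval (α ^ j.val) (Spoly N (chiSeq N S)) := by
  rw [aeval_Spoly_chiSeq hα, aeval_Spoly_chiSeq hα]
  refine Fintype.sum_equiv u.mulLeft _ _ fun x => ?_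
  have h : u.mulLeft x ∈ S ↔ x ∈ S := hu x
  have hval : α ^ (x * (u * j)).val = α ^ (u.mulLeft x * j).val := by
    rw [Units.mulLeft_apply, mul_left_comm, mul_assoc]
  by_cases hx : x ∈ S <;> simp only [h, hx, hval, if_true, if_false]

/-- On a cyclotomic class the sequence polynomial of a union of two classes is constant. -/
lemma aeval_Spoly_chiSeq_eq_of_mem_Dclass {N f : ℕ} [NeZero N] (hf : 0 < f) {β : ZMod N}
    (hβ : β ^ (4 * f) = 1) {F : Type*} [Field F] [Algebra (ZMod 2) F] {α : F} (hα : α ^ N = 1)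
    (c d : ℕ) {i : ℕ} {a b : ZMod N} (ha : a ∈ Dclass N f β i) (hb : b ∈ Dclass N f β i) :
    aeval (α ^ a.val) (Spoly N (chiSeq N (Dclass N f β c ∪ Dclass N f β d))) =
      aeval (α ^ b.val) (Spoly N (chiSeq N (Dclass N f β c ∪ Dclass N f β d))) := by
  obtain ⟨t, rfl⟩ := exists_eq_pow_mul_of_mem_Dclass hβ ha hb
  set S := Dclass N f β c ∪ Dclass N f β d
  have hmem (s : ℕ) {x : ZMod N} (hx : x ∈ S) : β ^ (4 * s) * x ∈ S :=
    hx.imp (Dclass_pow_mul hf hβ · s) (Dclass_pow_mul hf hβ · s)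
  have hinv : β ^ (4 * (t * (f - 1))) * β ^ (4 * t) = 1 := by
    rw [← pow_add, show 4 * (t * (f - 1)) + 4 * t = 4 * f * t by
      obtain ⟨f, rfl⟩ := Nat.exists_eq_succ_of_ne_zero hf.ne'
      simp only [Nat.succ_eq_add_one, Nat.add_sub_cancel]
      ring, pow_mul, hβ, one_pow]
  let u : (ZMod N)ˣ := ⟨β ^ (4 * t), β ^ (4 * (t * (f - 1))), by rw [mul_comm, hinv], hinv⟩
  refine (aeval_Spoly_chiSeq_mul hα u (fun x => ⟨fun hx => ?_, hmem t⟩) a).symm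
  have := hmem (t * (f - 1)) hx
  rwa [← mul_assoc, show β ^ (4 * (t * (f - 1))) * (u : ZMod N) = 1 from hinv, one_mul] at this

/-- The map `j ↦ α ^ (j (N + 1) / 2)` is injective on residues modulo an odd `N`. -/
lemma eq_of_pow_val_mul_half_eq {N : ℕ} [NeZero N] (hN : Odd N) {F : Type*} [Field F] {α : F}
    (hα : IsPrimitiveRoot α N) {a b : ZMod N}
    (h : α ^ (a.val * ((N + 1) / 2)) = α ^ (b.val * ((N + 1) / 2))) : a = b := by
  have hsq (c : ZMod N) : (α ^ (c.val * ((N + 1) / 2))) ^ 2 = α ^ c.val := by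
    obtain ⟨m, hm⟩ := hN
    rw [← pow_mul, mul_assoc, show (N + 1) / 2 * 2 = N + 1 by omega, mul_comm, pow_mul, pow_succ,
      hα.pow_eq_one, one_mul]
  refine ZMod.val_injective N (hα.pow_inj a.val_lt b.val_lt ?_)
  rw [← hsq a, h, hsq b]

/-- if `2 ∈ D_3`, at most one `j ∈ D_i` satisfies
`1 + α^{j(N+1)/2} S_v(α^j) = 0`, hence `1 + x^{(N+1)/2} S_v(x)` has at most 4 roots
among `{α^j : 1 ≤ j ≤ N-1}`. -/
theorem stmt19 (N f y : ℕ) (hprime : N.Prime) (hNf : N = 4 * f + 1) (hN5 : 5 ≤ N)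
    (hfy : f = y ^ 2) (hy : 0 < y) (hfodd : Odd f)
    (β : ZMod N) (hβ : orderOf β = N - 1)
    (F : Type*) [Field F] [Algebra (ZMod 2) F]
    (α : F) (hα : IsPrimitiveRoot α N)
    (h2 : (2 : ZMod N) ∈ Dclass N f β 3)
    (v : ℤ → ℕ)
    (hv : v = chiSeq N (Dclass N f β 1 ∪ Dclass N f β 2)) :
    (∀ i ∈ ({0, 1, 2, 3} : Set ℕ), ∀ j₁ ∈ Dclass N f β i, ∀ j₂ ∈ Dclass N f β i,
      1 + α ^ (j₁.val * ((N + 1) / 2)) * Polynomial.aeval (α ^ j₁.val) (Spoly N v) = 0 →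
      1 + α ^ (j₂.val * ((N + 1) / 2)) * Polynomial.aeval (α ^ j₂.val) (Spoly N v) = 0 →
      j₁ = j₂) ∧
    ({ζ : F | (∃ j : ℕ, 1 ≤ j ∧ j ≤ N - 1 ∧ ζ = α ^ j) ∧
        Polynomial.aeval ζ (1 + X ^ ((N + 1) / 2) * Spoly N v) = 0}).ncard ≤ 4 := by
  have : Fact N.Prime := ⟨hprime⟩
  have hf : 0 < f := by omega
  have hβ1 : β ^ (4 * f) = 1 := by
    rw [show 4 * f = orderOf β by omega, pow_orderOf_eq_one]
  have hodd : Odd N := ⟨2 * f, by omega⟩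
  have hinj : ∀ i, ∀ j₁ ∈ Dclass N f β i, ∀ j₂ ∈ Dclass N f β i,
      1 + α ^ (j₁.val * ((N + 1) / 2)) * Polynomial.aeval (α ^ j₁.val) (Spoly N v) = 0 →
      1 + α ^ (j₂.val * ((N + 1) / 2)) * Polynomial.aeval (α ^ j₂.val) (Spoly N v) = 0 →
      j₁ = j₂ := by
    intro i j₁ h₁ j₂ h₂ e₁ e₂
    subst hv
    rw [aeval_Spoly_chiSeq_eq_of_mem_Dclass hf hβ1 hα.pow_eq_one 1 2 h₁ h₂] at e₁
    refine eq_of_pow_val_mul_half_eq hodd hα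
      (mul_right_cancel₀ ?_ (add_left_cancel (e₁.trans e₂.symm)))
    intro h0
    simp [h0] at e₂
  refine ⟨fun i _ => hinj i, ?_⟩
  have hcls : ∀ ζ : F, ((∃ j : ℕ, 1 ≤ j ∧ j ≤ N - 1 ∧ ζ = α ^ j) ∧
      Polynomial.aeval ζ (1 + X ^ ((N + 1) / 2) * Spoly N v) = 0) →
      ∃ i < 4, ∃ a ∈ Dclass N f β i, ζ = α ^ a.val ∧
        1 + α ^ (a.val * ((N + 1) / 2)) * Polynomial.aeval (α ^ a.val) (Spoly N v) = 0 := by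
    rintro ζ ⟨⟨j, hj1, hjN, rfl⟩, hroot⟩
    have hval : (j : ZMod N).val = j := ZMod.val_cast_of_lt (by omega)
    have hj0 : (j : ZMod N) ≠ 0 := by
      intro h
      rw [h, ZMod.val_zero] at hval
      omega
    obtain ⟨i, hi, hmem⟩ := exists_mem_Dclass hf hNf hβ hj0
    refine ⟨i, hi, j, hmem, by rw [hval], ?_⟩
    simpa [hval, pow_mul] using hroot
  choose! g hg4 hg using hcls
  refine (Set.ncard_le_ncard_of_injOn g (t := Set.Iio 4) hg4 ?_ (Set.finite_Iio 4)).trans ?_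
  · intro ζ hζ ξ hξ h
    obtain ⟨a, ha, rfl, ea⟩ := hg ζ hζ
    obtain ⟨b, hb, rfl, eb⟩ := hg ξ hξ
    rw [h] at ha
    rw [hinj _ a ha b hb ea eb]
  · simp [Set.ncard_eq_toFinset_card']
end
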